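/- Let T > 1, ε > 0, and n ≥ 1 a natural number, and define K_n(u) = sin^{2n}((ε log T / n) u) / ((ε log T / n)^{2n-1} u^{2n}) for u ≠ 0, extended continuously at 0. Then K_n is nonnegative, integrable on ℝ, and its Fourier transform K̂_n(v) = ∫_ℝ K_n(u) e^{-ivu} du is a real-valued even function supported in {v : |v| ≤ 2 ε log T}. -/

import Mathlib

open MeasureTheory

lemma aux_ne_ae : ∀ᵐ u : ℝ, u ≠ 0 := by
  simp [ae_iff]

lemma aux_sinc_sq_int : Integrable (fun u : ℝ => Real.sinc u ^ 2) := by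
  refine (integrable_inv_one_add_sq.const_mul 2).mono'
    (Real.continuous_sinc.pow 2).aestronglyMeasurable (Filter.Eventually.of_forall fun u => ?_)
  rw [Real.norm_eq_abs, abs_of_nonneg (sq_nonneg _), ← div_eq_mul_inv,
    le_div_iff₀ (by positivity)]
  have h1 : Real.sinc u ^ 2 ≤ 1 := by
    rw [sq_le_one_iff_abs_le_one]; exact Real.abs_sinc_le_one u
  have h2 : Real.sinc u ^ 2 * u ^ 2 ≤ 1 := by
    by_cases hu : u = 0
    · simp [hu]
    · rw [Real.sinc_of_ne_zero hu, div_pow, div_mul_cancel₀ _ (pow_ne_zero 2 hu)]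
      exact Real.sin_sq_le_one u
  linarith

lemma aux_sinc_pow_int (m : ℕ) (hm : 2 ≤ m) : Integrable (fun u : ℝ => Real.sinc u ^ m) := by
  refine aux_sinc_sq_int.mono'
    (Real.continuous_sinc.pow m).aestronglyMeasurable (Filter.Eventually.of_forall fun u => ?_)
  rw [Real.norm_eq_abs, abs_pow, ← sq_abs (Real.sinc u)]
  exact pow_le_pow_of_le_one (abs_nonneg _) (Real.abs_sinc_le_one u) hm

lemma aux_G_int (k : ℝ) : Integrable (fun u : ℝ => (1 - Real.cos (k * u)) / u ^ 2) := by
  by_cases hk : k = 0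
  · simp [hk]
  have h := (aux_sinc_sq_int.comp_mul_left' (R := k / 2) (by positivity)).const_mul (k ^ 2 / 2)
  refine h.congr ?_
  filter_upwards [aux_ne_ae] with u hu
  have h0 : k / 2 * u ≠ 0 := by positivity
  have h1 : Real.cos (k * u) = 1 - 2 * Real.sin (k / 2 * u) ^ 2 := by
    rw [show k * u = 2 * (k / 2 * u) by ring, Real.cos_two_mul, Real.sin_sq]; ring
  rw [Real.sinc_of_ne_zero h0, h1]
  field_simp
  ring

lemma aux_G_val (k : ℝ) : ∫ u : ℝ, (1 - Real.cos (k * u)) / u ^ 2 =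
    |k| * ∫ u : ℝ, (1 - Real.cos u) / u ^ 2 := by
  by_cases hk : k = 0
  · simp [hk]
  have h := Measure.integral_comp_mul_left (fun y : ℝ => (1 - Real.cos y) / y ^ 2) k
  have h2 : (fun u : ℝ => (1 - Real.cos (k * u)) / u ^ 2) =
      fun u => k ^ 2 * ((1 - Real.cos (k * u)) / (k * u) ^ 2) := by
    funext u
    by_cases hu : u = 0
    · simp [hu]
    · field_simp
  rw [h2, integral_const_mul, h, smul_eq_mul, ← mul_assoc, abs_inv, ← sq_abs]
  have : |k| ≠ 0 := by positivity
  field_simp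

lemma aux_base (v : ℝ) (hv : 2 ≤ |v|) : ∫ u : ℝ, Real.sinc u ^ 2 * Real.cos (v * u) = 0 := by
  have h : (fun u : ℝ => Real.sinc u ^ 2 * Real.cos (v * u)) =ᵐ[volume] fun u =>
      (1 / 4) * ((1 - Real.cos ((v + 2) * u)) / u ^ 2) +
      (1 / 4) * ((1 - Real.cos ((v - 2) * u)) / u ^ 2) -
      (1 / 2) * ((1 - Real.cos (v * u)) / u ^ 2) := by
    filter_upwards [aux_ne_ae] with u hu
    rw [Real.sinc_of_ne_zero hu, add_mul, sub_mul, Real.cos_add, Real.cos_sub, Real.cos_two_mul,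
      div_pow, Real.sin_sq]
    field_simp
    ring
  rw [integral_congr_ae h, integral_sub, integral_add, integral_const_mul, integral_const_mul,
    integral_const_mul, aux_G_val, aux_G_val, aux_G_val v]
  · have : |v + 2| + |v - 2| = 2 * |v| := by
      rcases le_abs.1 hv with h | h
      · rw [abs_of_nonneg (by linarith : 0 ≤ v + 2), abs_of_nonneg (by linarith : 0 ≤ v - 2),
          abs_of_nonneg (by linarith : 0 ≤ v)]; ring
      · rw [abs_of_nonpos (by linarith : v + 2 ≤ 0), abs_of_nonpos (by linarith : v - 2 ≤ 0),
          abs_of_nonpos (by linarith : v ≤ 0)]; ring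
    linear_combination (1 / 4) * (∫ u : ℝ, (1 - Real.cos u) / u ^ 2) * this
  · exact (aux_G_int _).const_mul _
  · exact (aux_G_int _).const_mul _
  · exact ((aux_G_int _).const_mul _).add ((aux_G_int _).const_mul _)
  · exact (aux_G_int _).const_mul _

lemma aux_inner (v u : ℝ) :
    ∫ x in (-1 : ℝ)..1, Real.cos ((v + x) * u) = 2 * (Real.sinc u * Real.cos (v * u)) := by
  by_cases hu : u = 0
  · simp [hu]; norm_num
  have hd : ∀ x ∈ Set.uIcc (-1 : ℝ) 1,
      HasDerivAt (fun x => Real.sin ((v + x) * u) / u) (Real.cos ((v + x) * u)) x := by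
    intro x _
    have h1 : HasDerivAt (fun x : ℝ => (v + x) * u) (1 * u) x :=
      ((hasDerivAt_id x).const_add v).mul_const u
    have h2 := (h1.sin).div_const u
    rwa [one_mul, mul_div_cancel_right₀ _ hu] at h2
  rw [intervalIntegral.integral_eq_sub_of_hasDerivAt hd
    (Continuous.intervalIntegrable (by fun_prop) _ _), Real.sinc_of_ne_zero hu,
    add_mul, add_mul, Real.sin_add, Real.sin_add]
  simp
  field_simp
  ring

lemma aux_step (m : ℕ) (hm : 2 ≤ m) :
    ∀ v : ℝ, (m : ℝ) < |v| → ∫ u : ℝ, Real.sinc u ^ m * Real.cos (v * u) = 0 := by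
  induction m, hm using Nat.le_induction with
  | base => intro v hv; exact aux_base v (by exact_mod_cast hv.le)
  | succ m hm ih =>
    intro v hv
    push_cast at hv
    have h1 : (fun u : ℝ => Real.sinc u ^ (m + 1) * Real.cos (v * u)) = fun u =>
        (1 / 2) * ∫ x in Set.Ioc (-1 : ℝ) 1, Real.sinc u ^ m * Real.cos ((v + x) * u) := by
      funext u
      rw [integral_const_mul, ← intervalIntegral.integral_of_le (by norm_num), aux_inner]
      ring
    rw [h1, integral_const_mul, integral_integral_swap]
    · rw [setIntegral_eq_zero_of_forall_eq_zero, mul_zero]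
      intro x hx
      apply ih
      have := abs_sub_abs_le_abs_sub v (-x)
      have h3 : |-x| ≤ 1 := by rw [abs_neg]; exact abs_le.2 ⟨hx.1.le, hx.2⟩
      rw [sub_neg_eq_add] at this
      linarith
    · have hp := (aux_sinc_pow_int m hm).mul_prod
        (integrable_const (1 : ℝ) : Integrable _ (volume.restrict (Set.Ioc (-1 : ℝ) 1)))
      refine hp.mono (Continuous.aestronglyMeasurable ?_) (Filter.Eventually.of_forall fun z => ?_)
      · have := Real.continuous_sinc
        unfold Function.uncurry
        fun_prop
      · simp only [Function.uncurry, norm_mul, norm_one]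
        gcongr
        exact Real.abs_cos_le_one _

/-- With `K_n(u) = sin^(2n)((ε log T / n) u) / ((ε log T / n)^(2n-1) u^(2n))`, the function
`K_n` is nonnegative and integrable, and its Fourier transform is real-valued, even, and
supported in `{v : |v| ≤ 2 ε log T}`. -/
theorem kernel_fourier_properties (T ε : ℝ) (hT : 1 < T) (hε : 0 < ε) (n : ℕ) (hn : 1 ≤ n) :
    ∀ a K Khat, a = ε * Real.log T / n →
      K = (fun u : ℝ => Real.sin (a * u) ^ (2 * n) / (a ^ (2 * n - 1) * u ^ (2 * n))) →
      Khat = (fun v : ℝ => ∫ u : ℝ, (K u : ℂ) * Complex.exp (-(v * u) * Complex.I)) →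
      (∀ u, 0 ≤ K u) ∧ Integrable K ∧
      (∀ v, (Khat v).im = 0) ∧ (∀ v, Khat (-v) = Khat v) ∧
      (∀ v : ℝ, 2 * ε * Real.log T < |v| → Khat v = 0) := by
  intro a K Khat ha hK hKh
  have hn0 : (0 : ℝ) < n := by exact_mod_cast hn
  have hlog : 0 < Real.log T := Real.log_pos hT
  have ha0 : 0 < a := by rw [ha]; positivity
  have han : a * n = ε * Real.log T := by rw [ha]; field_simp
  have hKae : (fun u => a * Real.sinc (a * u) ^ (2 * n)) =ᵐ[volume] K := by
    filter_upwards [aux_ne_ae] with u hu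
    have h0 : a * u ≠ 0 := by positivity
    have h1 : a ^ (2 * n) = a ^ (2 * n - 1) * a := by
      rw [← pow_succ]; congr 1; omega
    rw [hK, Real.sinc_of_ne_zero h0, div_pow, mul_pow, h1]
    field_simp
  have hKint : Integrable K :=
    (((aux_sinc_pow_int (2 * n) (by omega)).comp_mul_left' ha0.ne').const_mul a).congr hKae
  have hKeven : ∀ u, K (-u) = K u := by
    intro u
    simp only [hK, mul_neg, Real.sin_neg, (even_two_mul n).neg_pow]
  have heven : ∀ v, Khat (-v) = Khat v := by
    intro v
    simp only [hKh]
    rw [← integral_neg_eq_self]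
    congr 1
    funext u
    rw [hKeven]
    push_cast
    ring_nf
  have him : ∀ v, (Khat v).im = 0 := by
    intro v
    rw [← Complex.conj_eq_iff_im, ← heven v]
    nth_rewrite 2 [heven v]
    simp only [hKh]
    rw [← integral_conj]
    congr 1
    funext u
    rw [map_mul, Complex.conj_ofReal, ← Complex.exp_conj]
    simp
  refine ⟨?_, hKint, him, heven, ?_⟩
  · intro u
    rw [hK]
    exact div_nonneg ((even_two_mul n).pow_nonneg _)
      (mul_nonneg (by positivity) ((even_two_mul n).pow_nonneg _))
  · intro v hv
    apply Complex.ext _ (him v)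
    have hexp : ∀ u : ℝ, Complex.exp (-(v * u) * Complex.I) =
        Complex.exp ((-(v * u) : ℝ) * Complex.I) := by intro u; push_cast; rfl
    have hint : Integrable (fun u : ℝ => (K u : ℂ) * Complex.exp (-(v * u) * Complex.I)) := by
      refine hKint.ofReal.mul_bdd (c := 1) (Continuous.aestronglyMeasurable (by fun_prop)) ?_
      refine Filter.Eventually.of_forall fun u => ?_
      rw [hexp, Complex.norm_exp_ofReal_mul_I]
    have hre : (Khat v).re = ∫ u : ℝ, K u * Real.cos (v * u) := by
      rw [hKh]
      have := integral_re hint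
      simp only [RCLike.re_eq_complex_re] at this
      rw [← this]
      congr 1
      funext u
      rw [hexp, Complex.re_ofReal_mul, Complex.exp_ofReal_mul_I_re, Real.cos_neg]
    rw [hre, Complex.zero_re]
    have h1 : (fun u : ℝ => K u * Real.cos (v * u)) =ᵐ[volume] fun u =>
        a * (fun y => Real.sinc y ^ (2 * n) * Real.cos (v / a * y)) (a * u) := by
      filter_upwards [hKae] with u hu
      rw [← hu]
      have : v / a * (a * u) = v * u := by field_simp
      simp only [this]
      ring
    rw [integral_congr_ae h1, integral_const_mul, Measure.integral_comp_mul_left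
        (fun y => Real.sinc y ^ (2 * n) * Real.cos (v / a * y)) a,
      aux_step (2 * n) (by omega)]
    · simp
    · rw [abs_div, abs_of_pos ha0, lt_div_iff₀ ha0]
      push_cast
      linarith
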